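/- arXiv:1310.7324 — 2 statements merged into one kernel-verified Lean document; each statement's English description precedes it below -/
import Mathlib

section
/- Let M ≥ 1 and let −∞ = τ_1 < τ_2 < … < τ_M < τ_{M+1} = +∞ be quantization boundaries (with τ_2, …, τ_M real), let w_1, …, w_M ∈ ℝ, and let ψ : ℝ → ℝ be the piecewise-constant function with ψ(r) = w_j for r ∈ [τ_j, τ_{j+1}). Then for every c, μ ∈ ℝ and σ > 0, ∫_ℝ (r − c) ψ(r) φ_{μ,σ}(r) dr = Σ_{j=1}^M w_j [ (σ/√(2π)) (E_j − E_{j+1}) + (μ − c) (Q_j − Q_{j+1}) ], where E_j = exp(−(τ_j−μ)²/(2σ²)) and Q_j = Q((τ_j−μ)/σ) for 2 ≤ j ≤ M, with the conventions E_1 = E_{M+1} = 0, Q_1 = 1, Q_{M+1} = 0. -/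
open MeasureTheory Real

/-- The Q-function: `Q(x) = (1/√(2π)) ∫_x^∞ exp(−t²/2) dt`. -/
noncomputable def Qfun (x : ℝ) : ℝ :=
  (Real.sqrt (2 * Real.pi))⁻¹ * ∫ t in Set.Ioi x, Real.exp (-(t ^ 2) / 2)

/-- Gaussian density with mean `μ` and variance `σ²`. -/
noncomputable def gpdf (μ σ t : ℝ) : ℝ :=
  (Real.sqrt (2 * Real.pi * σ ^ 2))⁻¹ * Real.exp (-((t - μ) ^ 2) / (2 * σ ^ 2))

/-- `r` lies in the `j`-th quantization cell `[τ_j, τ_{j+1})`, with the conventions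
`τ_1 = −∞` and `τ_{M+1} = +∞` (only `τ_2, …, τ_M` are real boundaries). -/
def InCell (M : ℕ) (τ : ℕ → ℝ) (j : ℕ) (r : ℝ) : Prop :=
  (j = 1 ∨ τ j ≤ r) ∧ (j = M ∨ r < τ (j + 1))

/-- `E_j = exp(−(τ_j−μ)²/(2σ²))` for `2 ≤ j ≤ M`, with conventions `E_1 = E_{M+1} = 0`. -/
noncomputable def Efun (M : ℕ) (τ : ℕ → ℝ) (μ σ : ℝ) (j : ℕ) : ℝ :=
  if 2 ≤ j ∧ j ≤ M then Real.exp (-((τ j - μ) ^ 2) / (2 * σ ^ 2)) else 0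

/-- `Q_j = Q((τ_j−μ)/σ)` for `2 ≤ j ≤ M`, with conventions `Q_1 = 1`, `Q_{M+1} = 0`. -/
noncomputable def Qbd (M : ℕ) (τ : ℕ → ℝ) (μ σ : ℝ) (j : ℕ) : ℝ :=
  if j = 1 then 1 else if 2 ≤ j ∧ j ≤ M then Qfun ((τ j - μ) / σ) else 0

lemma integrable_exp_neg_sq_div_two : Integrable fun t : ℝ => exp (-(t ^ 2) / 2) := by
  refine (integrable_exp_neg_mul_sq (b := 1 / 2) (by norm_num)).congr (ae_of_all _ fun t => ?_)
  simp only
  ring_nf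

lemma integrable_mul_exp_neg_sq_div_two :
    Integrable fun t : ℝ => t * exp (-(t ^ 2) / 2) := by
  refine (integrable_mul_exp_neg_mul_sq (b := 1 / 2) (by norm_num)).congr
    (ae_of_all _ fun t => ?_)
  simp only
  ring_nf

lemma integral_exp_neg_sq_div_two : ∫ t : ℝ, exp (-(t ^ 2) / 2) = √(2 * π) := by
  have h := integral_gaussian (1 / 2)
  rw [show π / (1 / 2) = 2 * π by ring] at h
  rw [← h]
  congr 1 with t
  ring_nf

lemma integral_mul_exp_neg_sq_div_two : ∫ t : ℝ, t * exp (-(t ^ 2) / 2) = 0 := by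
  have h := integral_neg_eq_self (fun t : ℝ => t * exp (-(t ^ 2) / 2)) volume
  simp only [neg_sq, neg_mul, integral_neg] at h
  linarith

lemma setIntegral_Ioi_mul_exp_neg_sq_div_two (s : ℝ) :
    ∫ t in Set.Ioi s, t * exp (-(t ^ 2) / 2) = exp (-(s ^ 2) / 2) := by
  have hd : ∀ x ∈ Set.Ici s,
      HasDerivAt (fun t : ℝ => -exp (-(t ^ 2) / 2)) (x * exp (-(x ^ 2) / 2)) x := by
    intro x _
    have h := (((hasDerivAt_id x).pow 2).neg.div_const 2).exp.neg
    convert! h using 1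
    simp
    ring
  have hl : Filter.Tendsto (fun t : ℝ => -exp (-(t ^ 2) / 2)) Filter.atTop (nhds 0) := by
    rw [← neg_zero]
    refine (tendsto_exp_atBot.comp ?_).neg
    refine Filter.Tendsto.atBot_div_const two_pos ?_
    exact Filter.tendsto_neg_atTop_atBot.comp (Filter.tendsto_pow_atTop two_ne_zero)
  rw [integral_Ioi_of_hasDerivAt_of_tendsto' hd
    integrable_mul_exp_neg_sq_div_two.integrableOn hl]
  ring

lemma gpdf_add_mul (μ : ℝ) {σ : ℝ} (hσ : 0 < σ) (t : ℝ) :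
    gpdf μ σ (μ + σ * t) = (√(2 * π))⁻¹ * σ⁻¹ * exp (-(t ^ 2) / 2) := by
  rw [gpdf, sqrt_mul (by positivity), sqrt_sq hσ.le, mul_inv]
  congr 2
  field_simp
  ring

lemma integral_eq_mul_integral_affine (f : ℝ → ℝ) (μ : ℝ) {σ : ℝ} (hσ : 0 < σ) :
    ∫ r, f r = σ * ∫ t, f (μ + σ * t) := by
  rw [Measure.integral_comp_mul_left (fun y => f (μ + y)), integral_add_left_eq_self f μ,
    abs_of_pos (inv_pos.2 hσ), smul_eq_mul, mul_inv_cancel_left₀ hσ.ne']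

lemma integrable_sub_mul_gpdf (c μ : ℝ) {σ : ℝ} (hσ : 0 < σ) :
    Integrable fun r => (r - c) * gpdf μ σ r := by
  have h : Integrable fun t : ℝ => (√(2 * π))⁻¹ * (t * exp (-(t ^ 2) / 2))
      + (√(2 * π))⁻¹ * σ⁻¹ * (μ - c) * exp (-(t ^ 2) / 2) :=
    (integrable_mul_exp_neg_sq_div_two.const_mul _).add
      (integrable_exp_neg_sq_div_two.const_mul _)
  refine ((h.comp_mul_left' (inv_ne_zero hσ.ne')).comp_sub_right μ).congr
    (ae_of_all _ fun r => ?_)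
  obtain ⟨t, rfl⟩ : ∃ t, r = μ + σ * t :=
    ⟨σ⁻¹ * (r - μ), by rw [mul_inv_cancel_left₀ hσ.ne', add_sub_cancel]⟩
  have ht : σ⁻¹ * (μ + σ * t - μ) = t := by
    rw [add_sub_cancel_left, inv_mul_cancel_left₀ hσ.ne']
  simp only [ht, gpdf_add_mul μ hσ]
  field_simp
  ring

/-- Standardization of the Gaussian first-moment integrand over a measurable set. -/
lemma setIntegral_sub_mul_gpdf (c μ : ℝ) {σ : ℝ} (hσ : 0 < σ) {U V : Set ℝ}
    (hU : MeasurableSet U) (hV : MeasurableSet V) (h : ∀ t, μ + σ * t ∈ U ↔ t ∈ V) :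
    ∫ r in U, (r - c) * gpdf μ σ r = σ / √(2 * π) * (∫ t in V, t * exp (-(t ^ 2) / 2))
      + (μ - c) * ((√(2 * π))⁻¹ * ∫ t in V, exp (-(t ^ 2) / 2)) := by
  rw [← integral_indicator hU, integral_eq_mul_integral_affine _ μ hσ, ← mul_assoc (μ - c),
    ← integral_const_mul, ← integral_const_mul, ← integral_const_mul, ← integral_add
      (integrable_mul_exp_neg_sq_div_two.integrableOn.const_mul _)
      (integrable_exp_neg_sq_div_two.integrableOn.const_mul _), ← integral_indicator hV]
  congr 1 with t
  by_cases ht : t ∈ V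
  · rw [Set.indicator_of_mem ((h t).2 ht), Set.indicator_of_mem ht, gpdf_add_mul μ hσ]
    field_simp
    ring
  · rw [Set.indicator_of_notMem (fun hc => ht ((h t).1 hc)), Set.indicator_of_notMem ht, mul_zero]

/-- The points lying in the cell `j` or in a later one. -/
def cellTail (M : ℕ) (τ : ℕ → ℝ) (j : ℕ) : Set ℝ :=
  {r | j ≤ M ∧ (j = 1 ∨ τ j ≤ r)}

lemma measurableSet_cellTail (M : ℕ) (τ : ℕ → ℝ) (j : ℕ) : MeasurableSet (cellTail M τ j) := by
  have h : cellTail M τ j = {_r | j ≤ M} ∩ ({_r | j = 1} ∪ Set.Ici (τ j)) := rfl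
  rw [h]
  exact (MeasurableSet.const _).inter ((MeasurableSet.const _).union measurableSet_Ici)

lemma setIntegral_cellTail {M : ℕ} (hM : 1 ≤ M) (τ : ℕ → ℝ) (c μ : ℝ) {σ : ℝ} (hσ : 0 < σ)
    {j : ℕ} (hj : 1 ≤ j) :
    ∫ r in cellTail M τ j, (r - c) * gpdf μ σ r =
      σ / √(2 * π) * Efun M τ μ σ j + (μ - c) * Qbd M τ μ σ j := by
  have hπ : √(2 * π) ≠ 0 := by positivity
  rcases hj.eq_or_lt with rfl | hj
  · have h : cellTail M τ 1 = Set.univ := by ext; simp [cellTail, hM]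
    rw [h, setIntegral_sub_mul_gpdf c μ hσ .univ .univ (by simp), setIntegral_univ,
      setIntegral_univ, integral_mul_exp_neg_sq_div_two, integral_exp_neg_sq_div_two,
      inv_mul_cancel₀ hπ]
    simp [Efun, Qbd]
  · by_cases hjM : j ≤ M
    · have h : cellTail M τ j = Set.Ici (τ j) := by
        ext; simp [cellTail, hjM, show j ≠ 1 by omega]
      rw [h, integral_Ici_eq_integral_Ioi, setIntegral_sub_mul_gpdf c μ hσ measurableSet_Ioi
        (measurableSet_Ioi (a := (τ j - μ) / σ)), setIntegral_Ioi_mul_exp_neg_sq_div_two]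
      · rw [Efun, Qbd, if_pos ⟨hj, hjM⟩, if_neg (by omega), if_pos ⟨hj, hjM⟩, Qfun]
        congr 3
        field_simp
      · intro t
        rw [Set.mem_Ioi, Set.mem_Ioi, div_lt_iff₀ hσ, sub_lt_iff_lt_add', mul_comm]
    · have h : cellTail M τ j = ∅ := by ext; simp [cellTail, hjM]
      simp [h, Efun, Qbd, hjM, show j ≠ 1 by omega]

lemma cellTail_subset {M : ℕ} {τ : ℕ → ℝ} (hτ : StrictMonoOn τ (Set.Icc 2 M)) {i j : ℕ}
    (hi : 1 ≤ i) (hij : i ≤ j) : cellTail M τ j ⊆ cellTail M τ i := by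
  rintro r ⟨hjM, hr⟩
  refine ⟨hij.trans hjM, ?_⟩
  rcases hi.eq_or_lt with rfl | hi
  · exact .inl rfl
  · refine .inr ((hτ.monotoneOn ⟨hi, hij.trans hjM⟩ ⟨le_trans hi hij, hjM⟩ hij).trans ?_)
    exact hr.resolve_left (by omega)

lemma eq_sum_indicator_cellTail {M : ℕ} (hM : 1 ≤ M) {τ : ℕ → ℝ}
    (hτ : StrictMonoOn τ (Set.Icc 2 M)) (w : ℕ → ℝ) (ψ g : ℝ → ℝ)
    (hψ : ∀ j ∈ Finset.Icc 1 M, ∀ r : ℝ, InCell M τ j r → ψ r = w j) (r : ℝ) :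
    ψ r * g r = ∑ j ∈ Finset.Icc 1 M,
      w j * ((cellTail M τ j).indicator g r - (cellTail M τ (j + 1)).indicator g r) := by
  classical
  set k := Nat.findGreatest (fun j => r ∈ cellTail M τ j) M with hk
  have h1 : r ∈ cellTail M τ 1 := ⟨hM, .inl rfl⟩
  have hk1 : 1 ≤ k := Nat.le_findGreatest hM h1
  have hkM : k ≤ M := Nat.findGreatest_le M
  have hrk : r ∈ cellTail M τ k := Nat.findGreatest_spec (P := fun j => r ∈ cellTail M τ j) hM h1
  have hgt : ∀ j, k < j → r ∉ cellTail M τ j := fun j hj hr =>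
    (Nat.le_findGreatest (P := fun j => r ∈ cellTail M τ j) hr.1 hr).not_gt hj
  have hcell : InCell M τ k r := by
    refine ⟨hrk.2, ?_⟩
    by_contra! h
    exact hgt (k + 1) k.lt_succ_self ⟨by omega, .inr h.2⟩
  have hkmem : k ∈ Finset.Icc 1 M := Finset.mem_Icc.2 ⟨hk1, hkM⟩
  rw [Finset.sum_eq_single_of_mem k hkmem, Set.indicator_of_mem hrk,
    Set.indicator_of_notMem (hgt _ k.lt_succ_self), hψ k hkmem r hcell, sub_zero]
  intro j hj hjk
  rw [Finset.mem_Icc] at hj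
  rcases hjk.lt_or_gt with h | h
  · rw [Set.indicator_of_mem (cellTail_subset hτ hj.1 h.le hrk),
      Set.indicator_of_mem (cellTail_subset hτ (by omega) h hrk), sub_self, mul_zero]
  · rw [Set.indicator_of_notMem (hgt _ h), Set.indicator_of_notMem (hgt _ (by omega)),
      sub_self, mul_zero]

theorem integral_piecewise_const_first_moment
    (M : ℕ) (hM : 1 ≤ M) (τ : ℕ → ℝ) (hτ : StrictMonoOn τ (Set.Icc 2 M))
    (w : ℕ → ℝ) (ψ : ℝ → ℝ)
    (hψ : ∀ j ∈ Finset.Icc 1 M, ∀ r : ℝ, InCell M τ j r → ψ r = w j)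
    (c μ σ : ℝ) (hσ : 0 < σ) :
    ∫ r : ℝ, (r - c) * ψ r * gpdf μ σ r =
      ∑ j ∈ Finset.Icc 1 M, w j *
        ((σ / Real.sqrt (2 * Real.pi)) * (Efun M τ μ σ j - Efun M τ μ σ (j + 1))
          + (μ - c) * (Qbd M τ μ σ j - Qbd M τ μ σ (j + 1))) := by
  have hg := integrable_sub_mul_gpdf c μ hσ
  have hgi : ∀ j, Integrable ((cellTail M τ j).indicator fun r => (r - c) * gpdf μ σ r) :=
    fun j => hg.indicator (measurableSet_cellTail M τ j)
  have hpt : ∀ r, (r - c) * ψ r * gpdf μ σ r = ∑ j ∈ Finset.Icc 1 M,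
      w j * ((cellTail M τ j).indicator (fun r => (r - c) * gpdf μ σ r) r
        - (cellTail M τ (j + 1)).indicator (fun r => (r - c) * gpdf μ σ r) r) := by
    intro r
    rw [← eq_sum_indicator_cellTail hM hτ w ψ _ hψ r]
    ring
  simp_rw [hpt]
  rw [integral_finsetSum]
  swap
  · exact fun j _ => ((hgi j).sub (hgi (j + 1))).const_mul (w j)
  refine Finset.sum_congr rfl fun j hj => ?_
  rw [integral_const_mul, integral_sub (hgi j) (hgi (j + 1)),
    integral_indicator (measurableSet_cellTail M τ j),
    integral_indicator (measurableSet_cellTail M τ (j + 1)),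
    setIntegral_cellTail hM τ c μ hσ (Finset.mem_Icc.1 hj).1,
    setIntegral_cellTail hM τ c μ hσ (Nat.le_add_left 1 j)]
  ring
end

section
/- Let α, M ≥ 1 be integers, η > 0, b_1, …, b_M ∈ ℝ^α, and let p_1, …, p_M > 0 satisfy Σ_{v=1}^M p_v = 1. Fix indices j, i and define Φ_{j,i} = ∫_{ℝ^α} (2πη²)^{−α/2} exp(−(‖z−b_j‖² + ‖z−b_i‖²)/(2η²)) / x(z) dz, where x(z) = Σ_{v=1}^M p_v exp(−‖z−b_v‖²/(2η²)). Then Φ_{j,i} = Σ_{n=0}^∞ Σ_{m=0}^n (−1)^{m+n} (n!/m!) Σ_{ℓ ∈ ℕ^M : Σ_v ℓ_v = n−m} ( Π_{v=1}^M p_v^{ℓ_v}/ℓ_v! ) Λ_ℓ, where Λ_ℓ = ∫_{ℝ^α} (2πη²)^{−α/2} exp(−(‖z−b_j‖² + ‖z−b_i‖² + Σ_{v=1}^M ℓ_v‖z−b_v‖²)/(2η²)) dz; the inner sums are finite sums and the outer series over n converges. (This is the series expansion at the heart of Lemma 4.) -/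
open MeasureTheory Real

/-- `x(z) = Σ_v p_v exp(−‖z−b_v‖²/(2η²))`. -/
noncomputable def xmix (α M : ℕ) (η : ℝ) (b : Fin M → EuclideanSpace ℝ (Fin α))
    (p : Fin M → ℝ) (z : EuclideanSpace ℝ (Fin α)) : ℝ :=
  ∑ v, p v * Real.exp (-‖z - b v‖ ^ 2 / (2 * η ^ 2))

/-- `N(z) = (2πη²)^{−α/2} exp(−(‖z−bj‖² + ‖z−bi‖²)/(2η²))`. -/
noncomputable def Nker (α : ℕ) (η : ℝ) (bj bi : EuclideanSpace ℝ (Fin α))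
    (z : EuclideanSpace ℝ (Fin α)) : ℝ :=
  (2 * Real.pi * η ^ 2) ^ (-(α : ℝ) / 2) *
    Real.exp (-(‖z - bj‖ ^ 2 + ‖z - bi‖ ^ 2) / (2 * η ^ 2))

/-- The Gaussian integral `Λ_ℓ` appearing in Lemma 4. -/
noncomputable def Λker (α M : ℕ) (η : ℝ) (bj bi : EuclideanSpace ℝ (Fin α))
    (b : Fin M → EuclideanSpace ℝ (Fin α)) (ℓ : Fin M → ℕ) : ℝ :=
  ∫ z : EuclideanSpace ℝ (Fin α),
    (2 * Real.pi * η ^ 2) ^ (-(α : ℝ) / 2) *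
      Real.exp (-(‖z - bj‖ ^ 2 + ‖z - bi‖ ^ 2 + ∑ v, (ℓ v : ℝ) * ‖z - b v‖ ^ 2)
        / (2 * η ^ 2))

lemma integrable_exp_neg_mul_norm_sub_sq {V : Type*} [NormedAddCommGroup V]
    [InnerProductSpace ℝ V] [FiniteDimensional ℝ V] [MeasurableSpace V] [BorelSpace V]
    {c : ℝ} (hc : 0 < c) (a : V) :
    Integrable fun z : V => Real.exp (-c * ‖z - a‖ ^ 2) := by
  have h := (GaussianFourier.integrable_cexp_neg_mul_sq_norm_add
    (b := (c : ℂ)) (by simpa using hc) 0 (0 : V)).norm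
  refine Integrable.comp_sub_right (f := fun z : V => Real.exp (-c * ‖z‖ ^ 2)) ?_ a
  refine h.congr (Filter.Eventually.of_forall fun z => ?_)
  simp [Complex.norm_exp, ← Complex.ofReal_pow]

/-- The multinomial theorem with the coefficients written through factorials. -/
lemma sum_pow_eq_factorial_mul_sum_antidiagonalTuple {K : Type*} [Field K] [CharZero K]
    {M : ℕ} (f : Fin M → K) (k : ℕ) :
    (∑ v, f v) ^ k = (k.factorial : K) *
      ∑ ℓ ∈ Finset.Nat.antidiagonalTuple M k, ∏ v, f v ^ ℓ v / ((ℓ v).factorial : K) := by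
  rw [Finset.sum_pow_eq_sum_piAntidiag, Finset.piAntidiag_univ_fin_eq_antidiagonalTuple,
    Finset.mul_sum]
  refine Finset.sum_congr rfl fun ℓ hℓ => ?_
  rw [Finset.Nat.mem_antidiagonalTuple] at hℓ
  have h : ((∏ v, ((ℓ v).factorial : K)) * (Nat.multinomial Finset.univ ℓ : K)) =
      k.factorial := by
    rw [← hℓ]
    exact_mod_cast Nat.multinomial_spec Finset.univ ℓ
  have h0 : (∏ v, ((ℓ v).factorial : K)) ≠ 0 :=
    Finset.prod_ne_zero_iff.mpr fun v _ => Nat.cast_ne_zero.mpr (Nat.factorial_ne_zero _)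
  rw [Finset.prod_div_distrib, ← h]
  field_simp

lemma one_sub_sum_pow_eq {K : Type*} [Field K] [CharZero K] {M : ℕ} (f : Fin M → K) (n : ℕ) :
    (1 - ∑ v, f v) ^ n = ∑ m ∈ Finset.range (n + 1),
      (-1 : K) ^ (m + n) * ((n.factorial : K) / (m.factorial : K)) *
        ∑ ℓ ∈ Finset.Nat.antidiagonalTuple M (n - m),
          ∏ v, f v ^ ℓ v / ((ℓ v).factorial : K) := by
  rw [sub_eq_add_neg, add_pow]
  refine Finset.sum_congr rfl fun m hm => ?_
  obtain ⟨k, rfl⟩ := Nat.exists_eq_add_of_le (Nat.lt_succ_iff.mp (Finset.mem_range.mp hm))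
  have hm0 : (m.factorial : K) ≠ 0 := Nat.cast_ne_zero.mpr (Nat.factorial_ne_zero _)
  have hk0 : (k.factorial : K) ≠ 0 := Nat.cast_ne_zero.mpr (Nat.factorial_ne_zero _)
  have hsign : (-1 : K) ^ (m + (m + k)) = (-1) ^ k := by
    rw [← add_assoc, pow_add, Even.neg_one_pow ⟨m, rfl⟩, one_mul]
  rw [Nat.add_sub_cancel_left, neg_pow, sum_pow_eq_factorial_mul_sum_antidiagonalTuple,
    Nat.cast_add_choose, hsign, one_pow]
  field_simp

lemma integrable_Nker (α : ℕ) {η : ℝ} (hη : 0 < η) (bj bi : EuclideanSpace ℝ (Fin α)) :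
    Integrable (Nker α η bj bi) := by
  have hc : 0 < 1 / (2 * η ^ 2) := by positivity
  refine ((integrable_exp_neg_mul_norm_sub_sq hc bj).const_mul
    ((2 * Real.pi * η ^ 2) ^ (-(α : ℝ) / 2))).mono' ?_ (Filter.Eventually.of_forall fun z => ?_)
  · unfold Nker
    exact Continuous.aestronglyMeasurable (by fun_prop)
  · rw [Nker, Real.norm_of_nonneg (by positivity)]
    gcongr
    rw [neg_div, neg_mul, neg_le_neg_iff, one_div_mul_eq_div]
    gcongr
    exact le_add_of_nonneg_right (by positivity)

lemma Nker_nonneg (α : ℕ) (η : ℝ) (bj bi z : EuclideanSpace ℝ (Fin α)) :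
    0 ≤ Nker α η bj bi z := by
  unfold Nker
  positivity

lemma continuous_xmix (α M : ℕ) (η : ℝ) (b : Fin M → EuclideanSpace ℝ (Fin α))
    (p : Fin M → ℝ) : Continuous (xmix α M η b p) := by
  unfold xmix
  fun_prop

lemma le_xmix (α M : ℕ) (η : ℝ) (b : Fin M → EuclideanSpace ℝ (Fin α)) {p : Fin M → ℝ}
    (hp : ∀ v, 0 < p v) (j : Fin M) (z : EuclideanSpace ℝ (Fin α)) :
    p j * Real.exp (-‖z - b j‖ ^ 2 / (2 * η ^ 2)) ≤ xmix α M η b p z :=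
  Finset.single_le_sum
    (f := fun v => p v * Real.exp (-‖z - b v‖ ^ 2 / (2 * η ^ 2)))
    (fun v _ => mul_nonneg (hp v).le (Real.exp_pos _).le) (Finset.mem_univ j)

lemma xmix_pos (α M : ℕ) (η : ℝ) (b : Fin M → EuclideanSpace ℝ (Fin α)) {p : Fin M → ℝ}
    (hp : ∀ v, 0 < p v) (j : Fin M) (z : EuclideanSpace ℝ (Fin α)) :
    0 < xmix α M η b p z :=
  (mul_pos (hp j) (Real.exp_pos _)).trans_le (le_xmix α M η b hp j z)

lemma xmix_le_one (α M : ℕ) (η : ℝ) (b : Fin M → EuclideanSpace ℝ (Fin α)) {p : Fin M → ℝ}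
    (hp : ∀ v, 0 < p v) (hsum : ∑ v, p v = 1) (z : EuclideanSpace ℝ (Fin α)) :
    xmix α M η b p z ≤ 1 := by
  rw [← hsum, xmix]
  refine Finset.sum_le_sum fun v _ => mul_le_of_le_one_right (hp v).le ?_
  rw [Real.exp_le_one_iff, neg_div]
  exact neg_nonpos.mpr (by positivity)

lemma integrable_Nker_div_xmix (α M : ℕ) {η : ℝ} (hη : 0 < η)
    (b : Fin M → EuclideanSpace ℝ (Fin α)) {p : Fin M → ℝ} (hp : ∀ v, 0 < p v) (j i : Fin M) :
    Integrable fun z => Nker α η (b j) (b i) z / xmix α M η b p z := by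
  have hc : 0 < 1 / (2 * η ^ 2) := by positivity
  refine ((integrable_exp_neg_mul_norm_sub_sq hc (b i)).const_mul
    ((2 * Real.pi * η ^ 2) ^ (-(α : ℝ) / 2) / p j)).mono' ?_
    (Filter.Eventually.of_forall fun z => ?_)
  · exact (integrable_Nker α hη (b j) (b i)).aestronglyMeasurable.div₀
      (continuous_xmix α M η b p).aestronglyMeasurable
  · have hx := xmix_pos α M η b hp j z
    have hpj := hp j
    rw [Real.norm_of_nonneg (div_nonneg (Nker_nonneg ..) hx.le), div_le_iff₀ hx]
    refine le_trans (le_of_eq ?_)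
      (mul_le_mul_of_nonneg_left (le_xmix α M η b hp j z) (by positivity))
    have hexp : Real.exp (-(‖z - b j‖ ^ 2 + ‖z - b i‖ ^ 2) / (2 * η ^ 2)) =
        Real.exp (-(1 / (2 * η ^ 2)) * ‖z - b i‖ ^ 2) *
          Real.exp (-‖z - b j‖ ^ 2 / (2 * η ^ 2)) := by
      rw [← Real.exp_add]
      ring_nf
    rw [Nker, hexp]
    field_simp

lemma Λker_integrand_eq (α M : ℕ) (η : ℝ) (bj bi : EuclideanSpace ℝ (Fin α))
    (b : Fin M → EuclideanSpace ℝ (Fin α)) (ℓ : Fin M → ℕ) (z : EuclideanSpace ℝ (Fin α)) :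
    (2 * Real.pi * η ^ 2) ^ (-(α : ℝ) / 2) *
      Real.exp (-(‖z - bj‖ ^ 2 + ‖z - bi‖ ^ 2 + ∑ v, (ℓ v : ℝ) * ‖z - b v‖ ^ 2)
        / (2 * η ^ 2)) =
      Nker α η bj bi z * ∏ v, Real.exp (-‖z - b v‖ ^ 2 / (2 * η ^ 2)) ^ ℓ v := by
  simp_rw [← Real.exp_nat_mul, mul_div_assoc', mul_neg]
  rw [Nker, ← Real.exp_sum, mul_assoc (_ ^ _), ← Real.exp_add, ← Finset.sum_div,
    Finset.sum_neg_distrib, ← add_div, neg_add _ (∑ v, _)]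

lemma integrable_Nker_mul_prod (α M : ℕ) {η : ℝ} (hη : 0 < η)
    (bj bi : EuclideanSpace ℝ (Fin α)) (b : Fin M → EuclideanSpace ℝ (Fin α))
    (ℓ : Fin M → ℕ) :
    Integrable fun z =>
      Nker α η bj bi z * ∏ v, Real.exp (-‖z - b v‖ ^ 2 / (2 * η ^ 2)) ^ ℓ v := by
  refine (integrable_Nker α hη bj bi).mono'
    ((integrable_Nker α hη bj bi).aestronglyMeasurable.mul
      (Continuous.aestronglyMeasurable (by fun_prop)))
    (Filter.Eventually.of_forall fun z => ?_)
  have hN := Nker_nonneg α η bj bi z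
  rw [Real.norm_of_nonneg (by positivity)]
  refine mul_le_of_le_one_right hN
    (Finset.prod_le_one (fun v _ => by positivity) fun v _ => pow_le_one₀ (by positivity) ?_)
  rw [Real.exp_le_one_iff, neg_div]
  exact neg_nonpos.mpr (by positivity)

lemma integral_Nker_mul_one_sub_xmix_pow (α M : ℕ) {η : ℝ} (hη : 0 < η)
    (bj bi : EuclideanSpace ℝ (Fin α)) (b : Fin M → EuclideanSpace ℝ (Fin α))
    (p : Fin M → ℝ) (n : ℕ) :
    ∫ z, Nker α η bj bi z * (1 - xmix α M η b p z) ^ n =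
      ∑ m ∈ Finset.range (n + 1),
        (-1 : ℝ) ^ (m + n) * ((n.factorial : ℝ) / (m.factorial : ℝ)) *
          ∑ ℓ ∈ Finset.Nat.antidiagonalTuple M (n - m),
            (∏ v, p v ^ ℓ v / ((ℓ v).factorial : ℝ)) * Λker α M η bj bi b ℓ := by
  have hpt (z) : Nker α η bj bi z * (1 - xmix α M η b p z) ^ n =
      ∑ m ∈ Finset.range (n + 1),
        (-1 : ℝ) ^ (m + n) * ((n.factorial : ℝ) / (m.factorial : ℝ)) *
          ∑ ℓ ∈ Finset.Nat.antidiagonalTuple M (n - m),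
            (∏ v, p v ^ ℓ v / ((ℓ v).factorial : ℝ)) *
              (Nker α η bj bi z * ∏ v, Real.exp (-‖z - b v‖ ^ 2 / (2 * η ^ 2)) ^ ℓ v) := by
    rw [xmix, one_sub_sum_pow_eq, Finset.mul_sum]
    refine Finset.sum_congr rfl fun m _ => ?_
    rw [mul_left_comm, Finset.mul_sum]
    congr 1
    refine Finset.sum_congr rfl fun ℓ _ => ?_
    simp_rw [mul_pow, mul_div_right_comm]
    rw [Finset.prod_mul_distrib]
    ring
  have hint (ℓ : Fin M → ℕ) := integrable_Nker_mul_prod α M hη bj bi b ℓ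
  simp_rw [hpt]
  rw [integral_finsetSum _ fun m _ =>
    (integrable_finsetSum _ fun ℓ _ => (hint ℓ).const_mul _).const_mul _]
  refine Finset.sum_congr rfl fun m _ => ?_
  rw [integral_const_mul, integral_finsetSum _ fun ℓ _ => (hint ℓ).const_mul _]
  simp_rw [integral_const_mul, Λker, Λker_integrand_eq]

theorem Phi_series_expansion
    (α M : ℕ) (hα : 1 ≤ α) (hM : 1 ≤ M) (η : ℝ) (hη : 0 < η)
    (b : Fin M → EuclideanSpace ℝ (Fin α)) (p : Fin M → ℝ)
    (hp : ∀ v, 0 < p v) (hsum : ∑ v, p v = 1) (j i : Fin M) :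
    HasSum
      (fun n : ℕ => ∑ m ∈ Finset.range (n + 1),
        (-1 : ℝ) ^ (m + n) * ((n.factorial : ℝ) / (m.factorial : ℝ)) *
          ∑ ℓ ∈ Finset.Nat.antidiagonalTuple M (n - m),
            (∏ v, p v ^ ℓ v / ((ℓ v).factorial : ℝ)) * Λker α M η (b j) (b i) b ℓ)
      (∫ z : EuclideanSpace ℝ (Fin α), Nker α η (b j) (b i) z / xmix α M η b p z) := by
  have hgeom (z) : HasSum (fun n : ℕ => Nker α η (b j) (b i) z * (1 - xmix α M η b p z) ^ n)
      (Nker α η (b j) (b i) z / xmix α M η b p z) := by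
    have h := (hasSum_geometric_of_lt_one (sub_nonneg.mpr (xmix_le_one α M η b hp hsum z))
      (sub_lt_self 1 (xmix_pos α M η b hp j z))).mul_left (Nker α η (b j) (b i) z)
    rwa [sub_sub_cancel, ← div_eq_mul_inv] at h
  simp_rw [← integral_Nker_mul_one_sub_xmix_pow α M hη]
  refine hasSum_integral_of_dominated_convergence
    (fun n z => Nker α η (b j) (b i) z * (1 - xmix α M η b p z) ^ n)
    (fun n => (integrable_Nker α hη (b j) (b i)).aestronglyMeasurable.mul
      ((continuous_const.sub (continuous_xmix α M η b p)).pow n).aestronglyMeasurable)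
    (fun n => Filter.Eventually.of_forall fun z => ?_)
    (Filter.Eventually.of_forall fun z => (hgeom z).summable) ?_
    (Filter.Eventually.of_forall hgeom)
  · exact (Real.norm_of_nonneg (mul_nonneg (Nker_nonneg ..)
      (pow_nonneg (sub_nonneg.mpr (xmix_le_one α M η b hp hsum z)) n))).le
  · simp_rw [fun z => (hgeom z).tsum_eq]
    exact integrable_Nker_div_xmix α M hη b hp j i
end
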